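/- arXiv:1412.5755 — 2 statements merged into one kernel-verified Lean document; each statement's English description precedes it below -/
import Mathlib

section
/- Let $k_1, k_2, K, V > 0$ and set $\mu_2 = k_1 V / k_2$ and $\mu_1 = \mu_2 (K + k_2)/K$ (the deterministic steady state of the linear reaction network). Define $p : \mathbb{Z}^2 \to \mathbb{R}$ by $p(x_1, x_2) = \frac{\mu_1^{x_1} \mu_2^{x_2}}{x_1! \, x_2!} e^{-(\mu_1 + \mu_2)}$ for $x_1, x_2 \ge 0$ and $p(x_1,x_2) = 0$ if $x_1 < 0$ or $x_2 < 0$. Then $p$ is a stationary solution of the chemical master equation of the network: for every $(x_1, x_2) \in \mathbb{N}^2$, $$k_1 V\, p(x_1-1, x_2) + k_2 (x_2+1)\, p(x_1, x_2+1) + K (x_1+1)\, p(x_1+1, x_2-1) + K (x_2+1)\, p(x_1-1, x_2+1) = \big(k_1 V + k_2 x_2 + K x_1 + K x_2\big)\, p(x_1, x_2).$$ -/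
/-- The product-Poisson distribution centred at the deterministic steady state of the
linear reaction network `∅ → X₁`, `X₂ → ∅`, `X₁ → X₂`, `X₂ → X₁` is a stationary
solution of the chemical master equation. -/
theorem stationary_CME_linear_system
    (k₁ k₂ K V : ℝ) (hk₁ : 0 < k₁) (hk₂ : 0 < k₂) (hK : 0 < K) (hV : 0 < V)
    (μ₁ μ₂ : ℝ) (hμ₂ : μ₂ = k₁ * V / k₂) (hμ₁ : μ₁ = μ₂ * (K + k₂) / K)
    (p : ℤ → ℤ → ℝ)
    (hp : ∀ x₁ x₂ : ℤ, p x₁ x₂ =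
      if 0 ≤ x₁ ∧ 0 ≤ x₂ then
        μ₁ ^ x₁.toNat * μ₂ ^ x₂.toNat /
          ((Nat.factorial x₁.toNat : ℝ) * (Nat.factorial x₂.toNat : ℝ)) *
          Real.exp (-(μ₁ + μ₂))
      else 0) :
    ∀ x₁ x₂ : ℕ,
      k₁ * V * p ((x₁ : ℤ) - 1) (x₂ : ℤ)
        + k₂ * ((x₂ : ℝ) + 1) * p (x₁ : ℤ) ((x₂ : ℤ) + 1)
        + K * ((x₁ : ℝ) + 1) * p ((x₁ : ℤ) + 1) ((x₂ : ℤ) - 1)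
        + K * ((x₂ : ℝ) + 1) * p ((x₁ : ℤ) - 1) ((x₂ : ℤ) + 1)
      = (k₁ * V + k₂ * (x₂ : ℝ) + K * (x₁ : ℝ) + K * (x₂ : ℝ)) * p (x₁ : ℤ) (x₂ : ℤ) := by
  have R1 : ∀ (n : ℕ) (z : ℤ), ((n : ℝ) + 1) * p ((n : ℤ) + 1) z = μ₁ * p n z := by
    intro n z
    rw [hp, hp]
    by_cases hz : 0 ≤ z
    · have h1 : (0 : ℤ) ≤ (n : ℤ) + 1 := by omega
      have h2 : ((n : ℤ) + 1).toNat = n + 1 := by omega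
      have hf := Nat.factorial_ne_zero n
      have hg := Nat.factorial_ne_zero z.toNat
      have hn : (n : ℝ) + 1 ≠ 0 := by positivity
      simp only [h1, hz, h2, Int.natCast_nonneg, and_self, if_true, Int.toNat_natCast,
        Nat.factorial_succ, pow_succ]
      push_cast
      field_simp
    · simp [hz]
  have R2 : ∀ (n : ℕ) (z : ℤ), ((n : ℝ) + 1) * p z ((n : ℤ) + 1) = μ₂ * p z n := by
    intro n z
    rw [hp, hp]
    by_cases hz : 0 ≤ z
    · have h1 : (0 : ℤ) ≤ (n : ℤ) + 1 := by omega
      have h2 : ((n : ℤ) + 1).toNat = n + 1 := by omega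
      have hf := Nat.factorial_ne_zero n
      have hg := Nat.factorial_ne_zero z.toNat
      have hn : (n : ℝ) + 1 ≠ 0 := by positivity
      simp only [h1, hz, h2, Int.natCast_nonneg, and_self, if_true, Int.toNat_natCast,
        Nat.factorial_succ, pow_succ]
      push_cast
      field_simp
    · simp [hz]
  have S1 : ∀ (n : ℕ) (z : ℤ), μ₁ * p ((n : ℤ) - 1) z = n * p n z := by
    intro n z
    cases n with
    | zero => simp [hp]
    | succ m =>
      have h := R1 m z
      push_cast
      rw [add_sub_cancel_right, h]
  have S2 : ∀ (n : ℕ) (z : ℤ), μ₂ * p z ((n : ℤ) - 1) = n * p z n := by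
    intro n z
    cases n with
    | zero => simp [hp]
    | succ m =>
      have h := R2 m z
      push_cast
      rw [add_sub_cancel_right, h]
  intro x₁ x₂
  have e2 : k₁ * V = k₂ * μ₂ := by rw [hμ₂]; field_simp
  have e1 : K * μ₁ = μ₂ * (K + k₂) := by rw [hμ₁]; field_simp
  have a := R2 x₂ x₁
  have b := R1 x₁ ((x₂ : ℤ) - 1)
  have c := R2 x₂ ((x₁ : ℤ) - 1)
  have d := S1 x₁ x₂
  have e := S2 x₂ x₁
  rw [e2]
  linear_combination k₂ * a + K * b + K * c + K * d + (K + k₂) * e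
    + (p x₁ ((x₂ : ℤ) - 1) - p ((x₁ : ℤ) - 1) x₂) * e1
end

section
/- Fix $k_1, k_2, V > 0$. For $K > 0$ set $\lambda_{\mathrm{QSSA}} = 2 k_1 V / k_2$ and $\lambda_0 = \lambda_{\mathrm{QSSA}} + k_1 V / K$. Then there exist constants $C > 0$ and $K_0 > 0$ such that for all $K \ge K_0$, the relative $\ell^2$ error incurred by the quasi-steady state approximation satisfies $$\mathrm{error}_{\mathrm{QSSA}} = \frac{\| \mathcal{P}(\lambda_{\mathrm{QSSA}}) - \mathcal{P}(\lambda_0) \|_2}{\| \mathcal{P}(\lambda_{\mathrm{QSSA}}) \|_2} \le \frac{C}{K},$$ i.e., the QSSA error for the linear system decays at rate $O(K^{-1})$ as $K \to \infty$. -/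
theorem aux_pow (a h : ℝ) (ha : 0 ≤ a) (h0 : 0 ≤ h) (h1 : h ≤ 1) (n : ℕ) :
    (a + h) ^ n - a ^ n ≤ h * n * (a + 1) ^ n := by
  induction n with
  | zero => simp
  | succ n ih =>
    have e1 : a ^ n ≤ (a + 1) ^ n := by gcongr; linarith
    have e2 : (a + h) * ((a + h) ^ n - a ^ n) ≤ (a + 1) * (h * n * (a + 1) ^ n) := by
      apply mul_le_mul (by linarith) ih _ (by linarith)
      have : a ^ n ≤ (a + h) ^ n := by gcongr; linarith
      linarith
    have e3 : h * a ^ n ≤ h * (a + 1) ^ n := by gcongr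
    have e4 : 0 ≤ h * (a * (a + 1) ^ n) := by positivity
    push_cast
    simp only [pow_succ]
    nlinarith

theorem aux_term (a h : ℝ) (ha : 0 ≤ a) (h0 : 0 ≤ h) (h1 : h ≤ 1) (n : ℕ) :
    (a ^ n / (Nat.factorial n : ℝ) * Real.exp (-a)
      - (a + h) ^ n / (Nat.factorial n : ℝ) * Real.exp (-(a + h))) ^ 2
      ≤ h ^ 2 * ((2 * (a + 1)) ^ n / (Nat.factorial n : ℝ)) ^ 2 := by
  have hx : a ^ n ≤ (a + h) ^ n := by gcongr; linarith
  have hx0 : 0 ≤ a ^ n := by positivity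
  have hy : (a + h) ^ n ≤ (a + 1) ^ n := by gcongr
  have hp := aux_pow a h ha h0 h1 n
  have hexp : 1 - h ≤ Real.exp (-h) := by have := Real.add_one_le_exp (-h); linarith
  have hexp1 : Real.exp (-h) ≤ 1 := by simpa using h0
  have hn : (n : ℝ) + 1 ≤ 2 ^ n := by exact_mod_cast Nat.lt_two_pow_self
  have hY : 0 ≤ (a + 1) ^ n := by positivity
  have hyh : (a + h) ^ n * (1 - Real.exp (-h)) ≤ (a + 1) ^ n * h :=
    mul_le_mul hy (by linarith) (by linarith) hY
  have hyh0 : 0 ≤ (a + h) ^ n * (1 - Real.exp (-h)) :=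
    mul_nonneg (by linarith) (by linarith)
  have hB : h * (a + 1) ^ n * (n + 1) ≤ h * (a + 1) ^ n * 2 ^ n := by gcongr
  have hn0 : 0 ≤ h * n * (a + 1) ^ n := by positivity
  have hn1 : 0 ≤ h * (a + 1) ^ n := by positivity
  have key : |a ^ n - (a + h) ^ n * Real.exp (-h)| ≤ h * (2 * (a + 1)) ^ n := by
    rw [mul_pow, abs_le]
    constructor <;> nlinarith
  have hea : Real.exp (-a) ≤ 1 := by simpa using ha
  have hf : (0 : ℝ) < Nat.factorial n := by positivity
  rw [← mul_pow, neg_add, Real.exp_add]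
  apply sq_le_sq'
  all_goals
    have e : a ^ n / (Nat.factorial n : ℝ) * Real.exp (-a)
      - (a + h) ^ n / (Nat.factorial n : ℝ) * (Real.exp (-a) * Real.exp (-h))
      = (a ^ n - (a + h) ^ n * Real.exp (-h)) * Real.exp (-a) / (Nat.factorial n : ℝ) := by
      ring
    have hb : |(a ^ n - (a + h) ^ n * Real.exp (-h)) * Real.exp (-a) / (Nat.factorial n : ℝ)|
        ≤ h * ((2 * (a + 1)) ^ n / (Nat.factorial n : ℝ)) := by
      rw [abs_div, abs_mul, abs_of_pos hf, Real.abs_exp, ← mul_div_assoc]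
      exact div_le_div_of_nonneg_right
        ((mul_le_of_le_one_right (abs_nonneg _) hea).trans key) hf.le
    rw [e]
    have := abs_le.1 hb
    linarith [this.1, this.2]

theorem aux_summable (z : ℝ) :
    Summable fun n : ℕ => (z ^ n / (Nat.factorial n : ℝ)) ^ 2 := by
  refine Summable.of_nonneg_of_le (fun n => sq_nonneg _) (fun n => ?_)
    (Real.summable_pow_div_factorial (z ^ 2))
  have hf : (1 : ℝ) ≤ Nat.factorial n := by exact_mod_cast Nat.factorial_pos n
  rw [div_pow, ← pow_mul, ← pow_mul, mul_comm 2 n]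
  have : 0 ≤ z ^ (n * 2) := by rw [pow_mul]; positivity
  gcongr
  nlinarith

/-- For the linear system, the relative `ℓ²` error incurred by the quasi-steady state
approximation decays at rate `O(K⁻¹)` as `K → ∞`, where the QSSA distribution
is `𝒫(λ_QSSA)` with `λ_QSSA = 2 k₁ V / k₂` and the exact distribution of the slow
variable is `𝒫(λ₀)` with `λ₀ = λ_QSSA + k₁ V / K`. -/
theorem QSSA_error_decay (k₁ k₂ V : ℝ) (hk₁ : 0 < k₁) (hk₂ : 0 < k₂) (hV : 0 < V) :
    ∃ C > 0, ∃ K₀ > 0, ∀ K : ℝ, K₀ ≤ K →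
      Real.sqrt (∑' n : ℕ,
          ((2 * k₁ * V / k₂) ^ n / (Nat.factorial n : ℝ) * Real.exp (-(2 * k₁ * V / k₂))
            - (2 * k₁ * V / k₂ + k₁ * V / K) ^ n / (Nat.factorial n : ℝ) *
                Real.exp (-(2 * k₁ * V / k₂ + k₁ * V / K))) ^ 2)
        / Real.sqrt (∑' n : ℕ,
            ((2 * k₁ * V / k₂) ^ n / (Nat.factorial n : ℝ) *
              Real.exp (-(2 * k₁ * V / k₂))) ^ 2)
        ≤ C / K := by
  obtain ⟨a, hadef⟩ : ∃ a, a = 2 * k₁ * V / k₂ := ⟨_, rfl⟩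
  have ha : 0 ≤ a := by rw [hadef]; positivity
  rw [← hadef]
  set D := Real.sqrt (∑' n : ℕ, (a ^ n / (Nat.factorial n : ℝ) * Real.exp (-a)) ^ 2)
  have hD : 0 ≤ D := Real.sqrt_nonneg _
  set M := ∑' n : ℕ, ((2 * (a + 1)) ^ n / (Nat.factorial n : ℝ)) ^ 2 with hM
  have hkV : 0 < k₁ * V := by positivity
  refine ⟨k₁ * V * Real.sqrt M / D + 1, by positivity, k₁ * V, hkV, fun K hK => ?_⟩
  have hK0 : 0 < K := lt_of_lt_of_le hkV hK
  have h0 : 0 ≤ k₁ * V / K := by positivity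
  have h1 : k₁ * V / K ≤ 1 := (div_le_one hK0).2 hK
  generalize hh : k₁ * V / K = h at h0 h1
  have hs := (aux_summable (2 * (a + 1))).mul_left (h ^ 2)
  have hle := Summable.tsum_le_tsum (aux_term a h ha h0 h1)
    (Summable.of_nonneg_of_le (fun n => sq_nonneg _) (aux_term a h ha h0 h1) hs) hs
  rw [tsum_mul_left, ← hM] at hle
  have h2 := Real.sqrt_le_sqrt hle
  rw [Real.sqrt_mul (sq_nonneg h), Real.sqrt_sq h0] at h2
  calc _ ≤ h * Real.sqrt M / D := by gcongr
    _ = (k₁ * V * Real.sqrt M / D) / K := by rw [← hh]; ring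
    _ ≤ _ := by gcongr; linarith
end
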